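/- Let φ be an unsatisfiable linear r-CNF formula. If there exists a (k + r − 1)-winning strategy for φ, then every configuration-style Res(⊕) refutation of φ whose inference steps use only the syntactic rules (resolution, simplification, syntactic weakening, addition) has space at least k. -/

import Mathlib

open Finset

/-- The two-element field. -/
abbrev F2 : Type := ZMod 2

/-- An `F2`-linear form in the variables `V`, given by its coefficients. -/
abbrev LinForm (V : Type) : Type := V → F2

/-- A linear literal: an equation `f = a` where `f` is a linear form and `a ∈ F2`. -/
abbrev LinLit (V : Type) : Type := LinForm V × F2

/-- A linear clause: a finite disjunction of linear literals. -/
abbrev LinClause (V : Type) : Type := Finset (LinLit V)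

/-- A linear system: a finite conjunction of linear equations. -/
abbrev LinSystem (V : Type) : Type := Finset (LinLit V)

/-- A linear CNF formula: a conjunction of linear clauses. -/
abbrev LinCNF (V : Type) : Type := Set (LinClause V)

variable {V : Type}

/-- Evaluation of a linear form at an assignment. -/
def evalForm [Fintype V] (f : LinForm V) (σ : V → F2) : F2 := ∑ v, f v * σ v

/-- The assignment `σ` satisfies the linear equation `l.1 = l.2`. -/
def LitSat [Fintype V] (σ : V → F2) (l : LinLit V) : Prop := evalForm l.1 σ = l.2

/-- The assignment `σ` satisfies the linear clause `C` (some literal of `C` holds). -/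
def ClauseSat [Fintype V] (σ : V → F2) (C : LinClause V) : Prop := ∃ l ∈ C, LitSat σ l

/-- The assignment `σ` is a solution of the linear system `S` (all equations hold). -/
def SysSat [Fintype V] (σ : V → F2) (S : LinSystem V) : Prop := ∀ l ∈ S, LitSat σ l

/-- The assignment `σ` satisfies the linear CNF `φ`. -/
def CNFSat [Fintype V] (σ : V → F2) (φ : LinCNF V) : Prop := ∀ C ∈ φ, ClauseSat σ C

/-- The linear CNF `φ` is unsatisfiable. -/
def Unsat [Fintype V] (φ : LinCNF V) : Prop := ¬ ∃ σ, CNFSat σ φ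

/-- The positive literal `v = 1` for a single variable `v`. -/
def posLit [DecidableEq V] (v : V) : LinLit V := (Pi.single v 1, 1)

/-- The negative literal `v = 0` for a single variable `v`. -/
def negLit [DecidableEq V] (v : V) : LinLit V := (Pi.single v 1, 0)

/-- A solution is `F`-proper if it satisfies every clause of `F`. -/
def FProper [Fintype V] (F : Set (LinClause V)) (σ : V → F2) : Prop := ∀ C ∈ F, ClauseSat σ C

/-- `φ` is `m`-extensible w.r.t. `F`: every linear system with fewer than `m` equations
that has an `F`-proper solution has, for each clause `C ∈ φ \ F`, an `F`-proper solution
satisfying `C`. -/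
def Extensible [Fintype V] (φ : LinCNF V) (F : Set (LinClause V)) (m : ℕ) : Prop :=
  ∀ S : LinSystem V, S.card < m → (∃ σ, SysSat σ S ∧ FProper F σ) →
    ∀ C ∈ φ \ F, ∃ τ, SysSat τ S ∧ FProper F τ ∧ ClauseSat τ C

/-- A configuration: a finite set of linear clauses kept in memory. -/
abbrev Config (V : Type) : Type := Finset (LinClause V)

/-- Semantic inference: `C` follows from clauses in `S` by the resolution rule or the
semantic weakening rule. -/
def InferSem [Fintype V] [DecidableEq V] (S : Config V) (C : LinClause V) : Prop :=
  (∃ (f : LinForm V) (A B : LinClause V),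
      insert (f, (0 : F2)) A ∈ S ∧ insert (f, (1 : F2)) B ∈ S ∧ C = A ∪ B) ∨
  (∃ D ∈ S, ∀ σ, ClauseSat σ D → ClauseSat σ C)

/-- The identically zero linear form. -/
def zeroForm (V : Type) : LinForm V := fun _ => 0

/-- Syntactic inference: `C` follows from clauses in `S` by the resolution rule,
the simplification rule, the syntactic weakening rule, or the addition rule. -/
def InferSyn [Fintype V] [DecidableEq V] (S : Config V) (C : LinClause V) : Prop :=
  (∃ (f : LinForm V) (A B : LinClause V),
      insert (f, (0 : F2)) A ∈ S ∧ insert (f, (1 : F2)) B ∈ S ∧ C = A ∪ B) ∨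
  (insert ((zeroForm V, (1 : F2)) : LinLit V) C ∈ S) ∨
  (∃ (D : LinClause V) (f : LinForm V) (α : F2), D ∈ S ∧ C = insert (f, α) D) ∨
  (∃ (D : LinClause V) (f₁ f₂ : LinForm V) (α₁ α₂ : F2),
      insert (f₁, α₁) (insert (f₂, α₂) D) ∈ S ∧
      C = insert (f₁, α₁) (insert (f₁ + f₂, α₁ + α₂ + 1) D))

/-- One step of a configuration-style refutation: download a clause of `φ`,
erase a clause, or add a clause inferred (via `Inf`) from the current configuration. -/
inductive ConfigStep [Fintype V] [DecidableEq V] (φ : LinCNF V)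
    (Inf : Config V → LinClause V → Prop) : Config V → Config V → Prop
  | download {S : Config V} {C : LinClause V} (h : C ∈ φ) : ConfigStep φ Inf S (insert C S)
  | erase {S : Config V} {C : LinClause V} (h : C ∈ S) : ConfigStep φ Inf S (S.erase C)
  | infer {S : Config V} {C : LinClause V} (h : Inf S C) : ConfigStep φ Inf S (insert C S)

/-- A configuration-style Res(⊕) refutation of `φ` with inference rules `Inf`:
a sequence of configurations starting from the empty configuration, each obtained from
the previous one by a basic step, ending with a configuration containing the empty
clause. -/
def IsConfigRefutation [Fintype V] [DecidableEq V] (φ : LinCNF V)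
    (Inf : Config V → LinClause V → Prop) (π : List (Config V)) : Prop :=
  π.head? = some (∅ : Config V) ∧ List.Chain' (ConfigStep φ Inf) π ∧
    ∃ S : Config V, π.getLast? = some S ∧ (∅ : LinClause V) ∈ S

/-- The space of a sequence of configurations: the maximum number of clauses in memory. -/
def spaceOf (π : List (Config V)) : ℕ := (π.map Finset.card).foldr max 0

/-- A `k`-winning strategy for the linear CNF `φ`: a nonempty family `H` of linear systems
such that (1) each member has at most `k` equations; (2) each member has, for every clause
`C` of `φ`, a solution satisfying `C`; (3) `H` is closed under semantically implied systems
with at most `k` equations; (4) each member with fewer than `k` equations can be extended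
by `f = a` for some `a ∈ F2` while remaining in `H`. -/
def IsWinningStrategy [Fintype V] [DecidableEq V] (φ : LinCNF V) (k : ℕ)
    (H : Set (LinSystem V)) : Prop :=
  H.Nonempty ∧
  (∀ F ∈ H, F.card ≤ k) ∧
  (∀ F ∈ H, ∀ C ∈ φ, ∃ σ, SysSat σ F ∧ ClauseSat σ C) ∧
  (∀ F ∈ H, ∀ G : LinSystem V, G.card ≤ k → (∀ σ, SysSat σ F → SysSat σ G) → G ∈ H) ∧
  (∀ F ∈ H, F.card < k → ∀ f : LinForm V, ∃ a : F2, insert ((f, a) : LinLit V) F ∈ H)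

/-- Every solution of `F` satisfies the equation `l`. -/
def ImpliesLit [Fintype V] (F : LinSystem V) (l : LinLit V) : Prop :=
  ∀ σ, SysSat σ F → LitSat σ l

/-- The system `F` implies some literal of every clause of the configuration `S`. -/
def Supports [Fintype V] (F : LinSystem V) (S : Config V) : Prop :=
  ∀ C ∈ S, ∃ l ∈ C, ImpliesLit F l

lemma impliesLit_of_mem [Fintype V] {F : LinSystem V} {l : LinLit V} (h : l ∈ F) :
    ImpliesLit F l :=
  fun _ hσ => hσ l h

lemma ImpliesLit.mono [Fintype V] {F G : LinSystem V} {l : LinLit V} (h : ImpliesLit F l)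
    (hFG : F ⊆ G) : ImpliesLit G l :=
  fun σ hσ => h σ fun m hm => hσ m (hFG hm)

lemma Supports.mono [Fintype V] {F G : LinSystem V} {S : Config V} (h : Supports F S)
    (hFG : F ⊆ G) : Supports G S := fun C hC =>
  let ⟨l, hl, hFl⟩ := h C hC
  ⟨l, hl, hFl.mono hFG⟩

lemma Supports.insert [Fintype V] [DecidableEq V] {F : LinSystem V} {S : Config V}
    (h : Supports F S) {C : LinClause V} {l : LinLit V} (hl : l ∈ C) (hFl : ImpliesLit F l) :
    Supports F (insert C S) := by
  intro D hD
  rcases Finset.mem_insert.1 hD with rfl | hD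
  · exact ⟨l, hl, hFl⟩
  · exact h D hD

lemma evalForm_add [Fintype V] (f g : LinForm V) (σ : V → F2) :
    evalForm (f + g) σ = evalForm f σ + evalForm g σ := by
  simp [evalForm, add_mul, Finset.sum_add_distrib]

lemma ImpliesLit.add [Fintype V] {F : LinSystem V} {f g : LinForm V} {a b : F2}
    (hf : ImpliesLit F (f, a)) (hg : ImpliesLit F (g, b)) : ImpliesLit F (f + g, a + b) := by
  intro σ hσ
  have h1 : evalForm f σ = a := hf σ hσ
  have h2 : evalForm g σ = b := hg σ hσ
  simp [LitSat, evalForm_add, h1, h2]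

lemma Unsat.exists_mem [Fintype V] {φ : LinCNF V} (h : Unsat φ) : ∃ C, C ∈ φ := by
  by_contra! hφ
  exact h ⟨0, fun C hC => absurd hC (hφ C)⟩

lemma card_le_spaceOf {π : List (Config V)} {S : Config V} (h : S ∈ π) :
    S.card ≤ spaceOf π := by
  induction π with
  | nil => simp at h
  | cons T π ih =>
    simp only [spaceOf, List.map_cons, List.foldr_cons] at ih ⊢
    rcases List.mem_cons.1 h with rfl | h
    · exact le_max_left _ _
    · exact (ih h).trans (le_max_right _ _)

lemma List.IsChain.forall_mem_of_head {α : Type*} {R : α → α → Prop} {P : α → Prop}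
    {l : List α} (hl : l.IsChain R) (hhead : ∀ a, l.head? = some a → P a)
    (hstep : ∀ a ∈ l, ∀ b ∈ l, R a b → P a → P b) : ∀ a ∈ l, P a := by
  induction hl with
  | nil => simp
  | singleton a => simpa using hhead
  | @cons_cons a b l hab _ ih =>
    have ha : P a := hhead a rfl
    have hb : P b := hstep a (by simp) b (by simp) hab ha
    have := ih (by simpa using hb) fun c hc d hd =>
      hstep c (List.mem_cons_of_mem _ hc) d (List.mem_cons_of_mem _ hd)
    intro c hc
    rcases List.mem_cons.1 hc with rfl | hc
    · exact ha
    · exact this c hc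

namespace IsWinningStrategy

variable [Fintype V] [DecidableEq V] {φ : LinCNF V} {m : ℕ} {H : Set (LinSystem V)}

lemma empty_mem (hH : IsWinningStrategy φ m H) : ∅ ∈ H := by
  obtain ⟨F, hF⟩ := hH.1
  exact hH.2.2.2.1 F hF ∅ (by simp) fun σ _ l hl => by simp at hl

lemma exists_sysSat (hH : IsWinningStrategy φ m H) (hφ : ∃ C, C ∈ φ) {F : LinSystem V}
    (hF : F ∈ H) : ∃ σ, SysSat σ F :=
  let ⟨C, hC⟩ := hφ
  let ⟨σ, hσ, _⟩ := hH.2.2.1 F hF C hC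
  ⟨σ, hσ⟩

lemma exists_card_le_of_supports (hH : IsWinningStrategy φ m H) {F : LinSystem V} (hF : F ∈ H)
    {S : Config V} (hS : Supports F S) (hm : S.card ≤ m) :
    ∃ G ∈ H, G.card ≤ S.card ∧ Supports G S := by
  choose! g hgC hFg using hS
  have hcard : (S.image g).card ≤ S.card := Finset.card_image_le
  refine ⟨S.image g, hH.2.2.2.1 F hF _ (hcard.trans hm) ?_, hcard, fun C hC =>
    ⟨g C, hgC C hC, impliesLit_of_mem (Finset.mem_image_of_mem g hC)⟩⟩
  intro σ hσ l hl
  obtain ⟨C, hC, rfl⟩ := Finset.mem_image.1 hl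
  exact hFg C hC σ hσ

lemma exists_superset_deciding (hH : IsWinningStrategy φ m H) {F : LinSystem V} (hF : F ∈ H)
    (T : Finset (LinLit V)) (hm : F.card + T.card ≤ m) :
    ∃ G ∈ H, F ⊆ G ∧ G.card ≤ F.card + T.card ∧ ∀ l ∈ T, ∃ a, (l.1, a) ∈ G := by
  induction T using Finset.induction_on with
  | empty => exact ⟨F, hF, subset_rfl, by simp, by simp⟩
  | insert l T hl ih =>
    rw [Finset.card_insert_of_notMem hl] at hm ⊢
    obtain ⟨G, hG, hFG, hcard, hdec⟩ := ih (by omega)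
    obtain ⟨a, ha⟩ := hH.2.2.2.2 G hG (by omega) l.1
    refine ⟨_, ha, hFG.trans (Finset.subset_insert _ _),
      (Finset.card_insert_le _ _).trans (by omega), fun l' hl' => ?_⟩
    rcases Finset.mem_insert.1 hl' with rfl | hl'
    · exact ⟨a, Finset.mem_insert_self _ _⟩
    · obtain ⟨b, hb⟩ := hdec l' hl'
      exact ⟨b, Finset.mem_insert_of_mem hb⟩

lemma supports_download (hH : IsWinningStrategy φ m H) {F : LinSystem V} (hF : F ∈ H)
    {S : Config V} (hS : Supports F S) {C : LinClause V} (hC : C ∈ φ)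
    (hm : F.card + C.card ≤ m) : ∃ G ∈ H, Supports G (insert C S) := by
  obtain ⟨G, hG, hFG, -, hdec⟩ := hH.exists_superset_deciding hF C hm
  obtain ⟨σ, hσ, l, hl, hσl⟩ := hH.2.2.1 G hG C hC
  obtain ⟨a, ha⟩ := hdec l hl
  have hal : (l.1, a) = l := Prod.ext rfl ((hσ _ ha).symm.trans hσl)
  exact ⟨G, hG, (hS.mono hFG).insert hl (impliesLit_of_mem (hal ▸ ha))⟩

lemma supports_infer (hH : IsWinningStrategy φ m H) (hφ : ∃ C, C ∈ φ) {F : LinSystem V}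
    (hF : F ∈ H) {S : Config V} (hS : Supports F S) {C : LinClause V} (hC : InferSyn S C)
    (hm : F.card < m) : ∃ G ∈ H, Supports G (insert C S) := by
  obtain ⟨σ, hσ⟩ := hH.exists_sysSat hφ hF
  rcases hC with ⟨f, A, B, hA, hB, rfl⟩ | h | ⟨D, f, α, hD, rfl⟩ | ⟨D, f₁, f₂, α₁, α₂, h, rfl⟩
  · obtain ⟨l, hl, hFl⟩ := hS _ hA
    obtain ⟨l', hl', hFl'⟩ := hS _ hB
    rcases Finset.mem_insert.1 hl with rfl | hl
    · rcases Finset.mem_insert.1 hl' with rfl | hl'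
      · exact absurd ((hFl σ hσ).symm.trans (hFl' σ hσ)) zero_ne_one
      · exact ⟨F, hF, hS.insert (Finset.mem_union_right _ hl') hFl'⟩
    · exact ⟨F, hF, hS.insert (Finset.mem_union_left _ hl) hFl⟩
  · obtain ⟨l, hl, hFl⟩ := hS _ h
    rcases Finset.mem_insert.1 hl with rfl | hl
    · have := hFl σ hσ
      simp [LitSat, evalForm, zeroForm] at this
    · exact ⟨F, hF, hS.insert hl hFl⟩
  · obtain ⟨l, hl, hFl⟩ := hS _ hD
    exact ⟨F, hF, hS.insert (Finset.mem_insert_of_mem hl) hFl⟩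
  · obtain ⟨l, hl, hFl⟩ := hS _ h
    rcases Finset.mem_insert.1 hl with rfl | hl
    · exact ⟨F, hF, hS.insert (Finset.mem_insert_self _ _) hFl⟩
    rcases Finset.mem_insert.1 hl with rfl | hl
    · obtain ⟨a, hG⟩ := hH.2.2.2.2 F hF hm f₁
      have hFG := Finset.subset_insert (f₁, a) F
      have hGf : ImpliesLit (insert (f₁, a) F) (f₁, a) :=
        impliesLit_of_mem (Finset.mem_insert_self _ _)
      refine ⟨_, hG, ?_⟩
      have ha : a = α₁ ∨ a = α₁ + 1 := by
        have key : ∀ a b : F2, a = b ∨ a = b + 1 := by decide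
        exact key a α₁
      rcases ha with rfl | rfl
      · exact (hS.mono hFG).insert (Finset.mem_insert_self _ _) hGf
      · refine (hS.mono hFG).insert
          (Finset.mem_insert_of_mem (Finset.mem_insert_self _ _)) ?_
        rw [add_right_comm]
        exact hGf.add (hFl.mono hFG)
    · exact ⟨F, hF, hS.insert (Finset.mem_insert_of_mem (Finset.mem_insert_of_mem hl)) hFl⟩

lemma supports_configStep (hH : IsWinningStrategy φ m H) (hφ : ∃ C, C ∈ φ) {r k : ℕ}
    (hr : ∀ C ∈ φ, C.card ≤ r) (hkm : k ≤ m) (hkrm : k + r ≤ m + 1) {S S' : Config V}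
    (hstep : ConfigStep φ InferSyn S S') (hcard : S.card < k) (hcard' : S'.card < k)
    (hS : ∃ F ∈ H, Supports F S) : ∃ F ∈ H, Supports F S' := by
  obtain ⟨F₀, hF₀, hS₀⟩ := hS
  obtain ⟨F, hF, hFcard, hS⟩ := hH.exists_card_le_of_supports hF₀ hS₀ (by omega)
  cases hstep with
  | @download C hC =>
    by_cases hCS : C ∈ S
    · exact ⟨F, hF, by rwa [Finset.insert_eq_self.2 hCS]⟩
    · rw [Finset.card_insert_of_notMem hCS] at hcard'
      have := hr C hC
      exact hH.supports_download hF hS hC (by omega)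
  | erase => exact ⟨F, hF, fun D hD => hS D (Finset.mem_of_mem_erase hD)⟩
  | infer hC => exact hH.supports_infer hφ hF hS hC (by omega)

end IsWinningStrategy

/-- If an unsatisfiable linear `r`-CNF `φ` has a `(k + r - 1)`-winning
strategy, then every configuration-style Res(⊕) refutation of `φ` using only the syntactic
rules has space at least `k`. -/
theorem syntactic_space_lower_bound_of_winning_strategy
    {V : Type} [Fintype V] [DecidableEq V] (φ : LinCNF V) (r k : ℕ)
    (hunsat : Unsat φ) (hr : ∀ C ∈ φ, C.card ≤ r)
    (H : Set (LinSystem V)) (hH : IsWinningStrategy φ (k + r - 1) H)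
    (π : List (Config V)) (hπ : IsConfigRefutation φ InferSyn π) :
    k ≤ spaceOf π := by
  have hφ := hunsat.exists_mem
  have hrpos : 0 < r := by
    obtain ⟨C, hC⟩ := hφ
    obtain ⟨_, _, l, hl, _⟩ := hH.2.2.1 ∅ hH.empty_mem C hC
    exact (Finset.card_pos.2 ⟨l, hl⟩).trans_le (hr C hC)
  by_contra! hk
  obtain ⟨hhead, hchain, S, hlast, hS⟩ := hπ
  have hgood : ∀ S ∈ π, ∃ F ∈ H, Supports F S := by
    refine List.IsChain.forall_mem_of_head hchain ?_ fun S hS S' hS' hstep =>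
      hH.supports_configStep hφ hr (k := k) (by omega) (by omega) hstep
        ((card_le_spaceOf hS).trans_lt hk) ((card_le_spaceOf hS').trans_lt hk)
    intro S hS
    obtain rfl : ∅ = S := Option.some.inj (hhead.symm.trans hS)
    exact ⟨∅, hH.empty_mem, by simp [Supports]⟩
  obtain ⟨F, -, hF⟩ := hgood S (List.mem_of_getLast? hlast)
  obtain ⟨l, hl, -⟩ := hF ∅ hS
  simp at hl
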